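/- arXiv:2012.06891 — 2 statements merged into one kernel-verified Lean document; each statement's English description precedes it below -/
import Mathlib

section
/- For every real number x, the series T(x) := Σ_{n ≥ 1} (xⁿ/n!) · (Σ_{π ∈ R_n} F_π) converges absolutely and T(x) = ∫_0^x e^{(x−t)·e^t + e^t + t − 1} dt. -/
open Finset
open scoped Classical

/-- `π : Fin n → ℕ` is a restricted growth sequence (entries are positive, the first entry
is `1`, and each entry exceeds the maximum of the previous entries by at most `1`;
equivalently `π₁ = 1` and `π_{j+1} ≤ 1 + max {π₁, …, π_j}`). -/
def IsRGS {n : ℕ} (π : Fin n → ℕ) : Prop :=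
  ∀ i : Fin n, 1 ≤ π i ∧ π i ≤ (Finset.univ.filter (fun j : Fin n => j < i)).sup π + 1

/-- The (finite) set `R_n` of restricted growth sequences of length `n`
(all such sequences take values in `{1, …, n}`). -/
noncomputable def RGS (n : ℕ) : Finset (Fin n → ℕ) :=
  (Fintype.piFinset fun _ : Fin n => Finset.Icc 1 n).filter IsRGS

/-- The (finite) set `R_{n,k}` of restricted growth sequences of length `n`
with maximal letter `k`. -/
noncomputable def RGSk (n k : ℕ) : Finset (Fin n → ℕ) :=
  (RGS n).filter (fun π => Finset.univ.sup π = k)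

/-- `F_π`: the number of fixed points of `π`, i.e. (1-indexed) positions `i` with `π_i = i`. -/
def fixCount {n : ℕ} (π : Fin n → ℕ) : ℕ :=
  (Finset.univ.filter (fun i : Fin n => π i = (i : ℕ) + 1)).card

/-- The number of ways to append `m` letters to a restricted growth sequence with maximal
letter `k` so that it remains a restricted growth sequence. -/
def extensionCount : ℕ → ℕ → ℕ
  | 0, _ => 1
  | m + 1, k => k * extensionCount m k + extensionCount m (k + 1)

lemma filter_lt_castSucc {p : ℕ} (i : Fin p) :
    Finset.univ.filter (fun j : Fin (p + 1) => j < i.castSucc) =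
      (Finset.univ.filter (fun j : Fin p => j < i)).map Fin.castSuccEmb := by
  ext j
  induction j using Fin.lastCases with
  | last => simp [(Fin.castSucc_lt_last i).not_gt, Fin.castSucc_ne_last]
  | cast j => simp

lemma filter_lt_last (p : ℕ) :
    Finset.univ.filter (fun j : Fin (p + 1) => j < Fin.last p) =
      (Finset.univ : Finset (Fin p)).map Fin.castSuccEmb := by
  ext j
  induction j using Fin.lastCases with
  | last => simp
  | cast j => simp [Fin.castSucc_lt_last]

lemma sup_snoc {p : ℕ} (π : Fin p → ℕ) (v : ℕ) :
    Finset.univ.sup (Fin.snoc π v : Fin (p + 1) → ℕ) = max (Finset.univ.sup π) v := by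
  apply le_antisymm
  · refine Finset.sup_le fun j _ => ?_
    induction j using Fin.lastCases with
    | last => simp
    | cast j => simpa using Or.inl (Finset.le_sup (f := π) (Finset.mem_univ j))
  · refine max_le (Finset.sup_le fun j _ => ?_) ?_
    · simpa using Finset.le_sup (f := (Fin.snoc π v : Fin (p + 1) → ℕ))
        (Finset.mem_univ j.castSucc)
    · simpa using Finset.le_sup (f := (Fin.snoc π v : Fin (p + 1) → ℕ))
        (Finset.mem_univ (Fin.last p))

lemma isRGS_snoc {p : ℕ} (π : Fin p → ℕ) (v : ℕ) :
    IsRGS (Fin.snoc π v : Fin (p + 1) → ℕ) ↔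
      IsRGS π ∧ 1 ≤ v ∧ v ≤ Finset.univ.sup π + 1 := by
  unfold IsRGS
  rw [Fin.forall_fin_succ']
  have h : (Fin.snoc π v : Fin (p + 1) → ℕ) ∘ Fin.castSuccEmb = π := by
    ext j
    simp
  simp only [filter_lt_castSucc, filter_lt_last, Finset.sup_map, h, Fin.snoc_castSucc,
    Fin.snoc_last]

lemma IsRGS.sup_le {p : ℕ} {π : Fin p → ℕ} (hπ : IsRGS π) : Finset.univ.sup π ≤ p := by
  induction p with
  | zero => simp
  | succ p ih =>
    rw [← Fin.snoc_init_self π] at hπ ⊢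
    obtain ⟨h, -, hv⟩ := (isRGS_snoc _ _).1 hπ
    have := ih h
    rw [sup_snoc]
    omega

lemma mem_RGS {p : ℕ} {π : Fin p → ℕ} : π ∈ RGS p ↔ IsRGS π := by
  simp only [RGS, Finset.mem_filter, Fintype.mem_piFinset, Finset.mem_Icc, and_iff_right_iff_imp]
  exact fun h i => ⟨(h i).1, (Finset.le_sup (f := π) (Finset.mem_univ i)).trans h.sup_le⟩

lemma fixCount_snoc {p : ℕ} (π : Fin p → ℕ) (v : ℕ) :
    fixCount (Fin.snoc π v : Fin (p + 1) → ℕ) = fixCount π + if v = p + 1 then 1 else 0 := by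
  unfold fixCount
  rw [Finset.card_filter, Finset.card_filter, Fin.sum_univ_castSucc]
  simp only [Fin.snoc_castSucc, Fin.snoc_last, Fin.val_castSucc, Fin.val_last]

lemma sum_RGS_succ {p : ℕ} (f : (Fin (p + 1) → ℕ) → ℕ) :
    ∑ σ ∈ RGS (p + 1), f σ =
      ∑ π ∈ RGS p, ∑ v ∈ Finset.Icc 1 (Finset.univ.sup π + 1), f (Fin.snoc π v) := by
  rw [Finset.sum_sigma']
  refine Finset.sum_bij' (fun σ _ => ⟨Fin.init σ, σ (Fin.last p)⟩)
    (fun q _ => Fin.snoc q.1 q.2) ?_ ?_ ?_ ?_ ?_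
  · intro σ hσ
    rw [mem_RGS, ← Fin.snoc_init_self σ, isRGS_snoc] at hσ
    simpa [mem_RGS] using hσ
  · intro q hq
    simpa [mem_RGS, isRGS_snoc] using hq
  · intro σ _
    simp
  · intro q _
    simp
  · intro σ _
    simp

lemma sum_RGS_sup_eq (p : ℕ) :
    ∑ π ∈ RGS p, (if Finset.univ.sup π = p then 1 else 0) = 1 := by
  induction p with
  | zero =>
    have : RGS 0 = Finset.univ := by
      ext π
      simp only [mem_RGS, IsRGS, Finset.mem_univ, iff_true]
      exact fun i => i.elim0
    simp [this]
  | succ p ih =>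
    rw [sum_RGS_succ]
    refine Eq.trans ?_ ih
    refine Finset.sum_congr rfl fun π hπ => ?_
    have hp := (mem_RGS.1 hπ).sup_le
    simp only [sup_snoc]
    rw [Finset.sum_congr rfl (g := fun v => if v = p + 1 then 1 else 0)]
    · simp only [Finset.sum_ite_eq', Finset.mem_Icc]
      exact if_congr (by omega) rfl rfl
    · intro v _
      exact if_congr (by omega) rfl rfl

lemma sum_extensionCount_max (m k : ℕ) :
    ∑ v ∈ Finset.Icc 1 (k + 1), extensionCount m (max k v) = extensionCount (m + 1) k := by
  rw [Finset.sum_Icc_succ_top (by omega), Finset.sum_congr rfl (g := fun _ => extensionCount m k)]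
  · simp [extensionCount]
  · intro v hv
    rw [max_eq_left (Finset.mem_Icc.1 hv).2]

lemma sum_fixCount_mul_extensionCount_succ (p m : ℕ) :
    ∑ σ ∈ RGS (p + 1), fixCount σ * extensionCount m (Finset.univ.sup σ) =
      ∑ π ∈ RGS p, fixCount π * extensionCount (m + 1) (Finset.univ.sup π) +
        extensionCount m (p + 1) := by
  rw [sum_RGS_succ]
  simp only [sup_snoc, fixCount_snoc, add_mul, Finset.sum_add_distrib, ← Finset.mul_sum,
    sum_extensionCount_max]
  congr 1
  refine Eq.trans ?_ (congrArg (· * extensionCount m (p + 1)) (sum_RGS_sup_eq p) |>.trans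
    (one_mul _))
  simp only [Finset.sum_mul]
  refine Finset.sum_congr rfl fun π hπ => ?_
  have hp := (mem_RGS.1 hπ).sup_le
  simp only [ite_mul, one_mul, zero_mul, Finset.sum_ite_eq', Finset.mem_Icc]
  rw [max_eq_right (by omega)]
  exact if_congr (by omega) rfl rfl

lemma sum_fixCount_mul_extensionCount (p m : ℕ) :
    ∑ π ∈ RGS p, fixCount π * extensionCount m (Finset.univ.sup π) =
      ∑ i ∈ Finset.range p, extensionCount (m + p - 1 - i) (i + 1) := by
  induction p generalizing m with
  | zero => simp [fixCount]
  | succ p ih =>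
    rw [sum_fixCount_mul_extensionCount_succ, ih, Finset.sum_range_succ]
    congr 1
    · refine Finset.sum_congr rfl fun i _ => ?_
      congr 1
      omega
    · congr 1
      omega

lemma sum_fixCount (n : ℕ) :
    ∑ π ∈ RGS (n + 1), fixCount π =
      ∑ q ∈ Finset.HasAntidiagonal.antidiagonal n, extensionCount q.2 (q.1 + 1) := by
  rw [Finset.Nat.sum_antidiagonal_eq_sum_range_succ_mk]
  simpa [extensionCount] using sum_fixCount_mul_extensionCount (n + 1) 0

lemma hasSum_of_eq {ι : Type*} {f g : ι → ℝ} {a b : ℝ} (h : HasSum f a)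
    (hfg : ∀ i, g i = f i) (hab : b = a) : HasSum g b := by
  rwa [funext hfg, hab]

lemma hasSum_pow_div_factorial (y : ℝ) :
    HasSum (fun n : ℕ => y ^ n / n.factorial) (Real.exp y) := by
  rw [Real.exp_eq_exp_ℝ]
  exact NormedSpace.expSeries_div_hasSum_exp y

/-- A Dobiński-type formula for `extensionCount`. -/
lemma hasSum_extensionCount (m k : ℕ) :
    HasSum (fun j : ℕ => ((j : ℝ) + k) ^ m / j.factorial)
      (Real.exp 1 * extensionCount m k) := by
  induction m generalizing k with
  | zero => simpa [extensionCount] using hasSum_pow_div_factorial 1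
  | succ m ih =>
    have h : HasSum (fun j : ℕ => (j : ℝ) * ((j : ℝ) + k) ^ m / j.factorial)
        (Real.exp 1 * extensionCount m (k + 1)) := by
      rw [← hasSum_nat_add_iff' 1]
      refine hasSum_of_eq (ih (k + 1)) (fun j => ?_) (by simp)
      · rw [Nat.factorial_succ]
        push_cast
        have : (j.factorial : ℝ) ≠ 0 := by positivity
        field_simp
        ring
    refine hasSum_of_eq (((ih k).mul_left (k : ℝ)).add h) (fun j => ?_) ?_
    · ring
    · simp only [extensionCount]
      push_cast
      ring

/-- The exponential generating function of `extensionCount · k`. -/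
lemma hasSum_extensionCount_egf (k : ℕ) (y : ℝ) :
    HasSum (fun m : ℕ => extensionCount m k * (y ^ m / m.factorial))
      (Real.exp (k * y + Real.exp y - 1)) := by
  have hrow (z : ℝ) (j : ℕ) : HasSum
      (fun m : ℕ => z ^ m / m.factorial * (((j : ℝ) + k) ^ m / j.factorial))
      (Real.exp (k * z) * (Real.exp z ^ j / j.factorial)) := by
    refine hasSum_of_eq ((hasSum_pow_div_factorial (((j : ℝ) + k) * z)).div_const
      (j.factorial : ℝ)) (fun m => ?_) ?_
    · rw [mul_pow]
      ring
    · rw [add_mul, Real.exp_add, Real.exp_nat_mul z j]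
      ring
  have htotal (z : ℝ) : HasSum
      (fun j : ℕ => Real.exp (k * z) * (Real.exp z ^ j / j.factorial))
      (Real.exp (k * z) * Real.exp (Real.exp z)) :=
    (hasSum_pow_div_factorial _).mul_left _
  have hs : Summable (fun q : ℕ × ℕ =>
      y ^ q.2 / q.2.factorial * (((q.1 : ℝ) + k) ^ q.2 / q.1.factorial)) := by
    refine Summable.of_norm ?_
    have he : (fun q : ℕ × ℕ =>
        ‖y ^ q.2 / q.2.factorial * (((q.1 : ℝ) + k) ^ q.2 / q.1.factorial)‖) =
        fun q : ℕ × ℕ =>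
          |y| ^ q.2 / q.2.factorial * (((q.1 : ℝ) + k) ^ q.2 / q.1.factorial) := by
      ext q
      have : |(q.1 : ℝ) + k| = q.1 + k := abs_of_nonneg (by positivity)
      simp [this]
    rw [he, summable_prod_of_nonneg fun q => by positivity]
    refine ⟨fun j => (hrow |y| j).summable, ?_⟩
    simpa only [(hrow |y| _).tsum_eq] using (htotal |y|).summable
  have hsum := hs.hasSum
  rw [(hsum.prod_fiberwise (hrow y)).unique (htotal y)] at hsum
  have hswap := ((Equiv.prodComm ℕ ℕ).hasSum_iff.2 hsum).prod_fiberwise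
    (fun m => (hasSum_extensionCount m k).mul_left (y ^ m / m.factorial))
  refine hasSum_of_eq (hswap.mul_left (Real.exp (-1))) (fun m => ?_) ?_
  · have h1 : Real.exp (-1) * Real.exp 1 = 1 := by rw [← Real.exp_add]; simp
    linear_combination (-(extensionCount m k * (y ^ m / m.factorial)) : ℝ) * h1
  · rw [← Real.exp_add, ← Real.exp_add]
    ring_nf

lemma hasSum_pow_mul_extensionCount (a t : ℝ) :
    HasSum (fun q : ℕ × ℕ => a ^ q.1 / q.1.factorial *
        (extensionCount q.2 (q.1 + 1) * (t ^ q.2 / q.2.factorial)))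
      (Real.exp (a * Real.exp t + Real.exp t + t - 1)) := by
  have hrow (b z : ℝ) (i : ℕ) : HasSum
      (fun m : ℕ => b ^ i / i.factorial *
        (extensionCount m (i + 1) * (z ^ m / m.factorial)))
      (Real.exp (Real.exp z + z - 1) * ((b * Real.exp z) ^ i / i.factorial)) := by
    refine hasSum_of_eq ((hasSum_extensionCount_egf (i + 1) z).mul_left (b ^ i / i.factorial))
      (fun _ => rfl) ?_
    have : ((i + 1 : ℕ) : ℝ) * z + Real.exp z - 1 = (Real.exp z + z - 1) + i * z := by
      push_cast
      ring
    rw [this, Real.exp_add, Real.exp_nat_mul, mul_pow]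
    ring
  have htotal (b z : ℝ) : HasSum
      (fun i : ℕ => Real.exp (Real.exp z + z - 1) * ((b * Real.exp z) ^ i / i.factorial))
      (Real.exp (Real.exp z + z - 1) * Real.exp (b * Real.exp z)) :=
    (hasSum_pow_div_factorial _).mul_left _
  have hs : Summable (fun q : ℕ × ℕ => a ^ q.1 / q.1.factorial *
        (extensionCount q.2 (q.1 + 1) * (t ^ q.2 / q.2.factorial))) := by
    refine Summable.of_norm ?_
    have he : (fun q : ℕ × ℕ => ‖a ^ q.1 / q.1.factorial *
        (extensionCount q.2 (q.1 + 1) * (t ^ q.2 / q.2.factorial))‖) =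
        fun q : ℕ × ℕ => |a| ^ q.1 / q.1.factorial *
        (extensionCount q.2 (q.1 + 1) * (|t| ^ q.2 / q.2.factorial)) := by
      ext q
      simp
    rw [he, summable_prod_of_nonneg fun q => by positivity]
    refine ⟨fun i => (hrow |a| |t| i).summable, ?_⟩
    simpa only [(hrow |a| |t| _).tsum_eq] using (htotal |a| |t|).summable
  have hsum := hs.hasSum
  rw [(hsum.prod_fiberwise (hrow a t)).unique (htotal a t), ← Real.exp_add] at hsum
  refine hasSum_of_eq hsum (fun _ => rfl) ?_
  ring_nf

lemma integral_pow_div_factorial_mul (x : ℝ) (i m : ℕ) :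
    ∫ t in (0 : ℝ)..x, (x - t) ^ i / i.factorial * (t ^ m / m.factorial) =
      x ^ (i + m + 1) / (i + m + 1).factorial := by
  have hderiv (n : ℕ) (t : ℝ) :
      HasDerivAt (fun t : ℝ => t ^ (n + 1) / (n + 1).factorial) (t ^ n / n.factorial) t := by
    refine ((hasDerivAt_pow (n + 1) t).div_const ((n + 1).factorial : ℝ)).congr_deriv ?_
    rw [Nat.factorial_succ]
    push_cast
    have : (n.factorial : ℝ) ≠ 0 := by positivity
    field_simp
  induction i generalizing m with
  | zero =>
    simp only [pow_zero, Nat.factorial_zero, Nat.cast_one, div_one, one_mul, zero_add]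
    rw [intervalIntegral.integral_eq_sub_of_hasDerivAt (fun t _ => hderiv m t)
      (Continuous.intervalIntegrable (by fun_prop) _ _)]
    simp
  | succ i ih =>
    have hu (t : ℝ) : HasDerivAt (fun t : ℝ => (x - t) ^ (i + 1) / (i + 1).factorial)
        (-((x - t) ^ i / i.factorial)) t := by
      exact ((hderiv i (x - t)).comp t ((hasDerivAt_id t).const_sub x)).congr_deriv (by simp)
    rw [intervalIntegral.integral_mul_deriv_eq_deriv_mul (fun t _ => hu t)
      (fun t _ => hderiv m t) (Continuous.intervalIntegrable (by fun_prop) _ _)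
      (Continuous.intervalIntegrable (by fun_prop) _ _)]
    simp only [neg_mul, intervalIntegral.integral_neg, ih]
    simp [show i + (m + 1) + 1 = i + 1 + m + 1 by ring]

lemma hasSum_integral_extensionCount (x : ℝ) :
    HasSum (fun q : ℕ × ℕ =>
        extensionCount q.2 (q.1 + 1) * (x ^ (q.1 + q.2 + 1) / (q.1 + q.2 + 1).factorial))
      (∫ t in (0 : ℝ)..x, Real.exp ((x - t) * Real.exp t + Real.exp t + t - 1)) := by
  have hbound := (hasSum_pow_mul_extensionCount |x| |x|).summable
  have h := intervalIntegral.hasSum_integral_of_dominated_convergence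
    (μ := MeasureTheory.volume) (a := 0) (b := x)
    (F := fun (q : ℕ × ℕ) (t : ℝ) => (x - t) ^ q.1 / q.1.factorial *
        (extensionCount q.2 (q.1 + 1) * (t ^ q.2 / q.2.factorial)))
    (f := fun t => Real.exp ((x - t) * Real.exp t + Real.exp t + t - 1))
    (fun q _ => |x| ^ q.1 / q.1.factorial *
        (extensionCount q.2 (q.1 + 1) * (|x| ^ q.2 / q.2.factorial)))
    (fun q => Continuous.aestronglyMeasurable (by fun_prop))
    (fun q => Filter.Eventually.of_forall fun t ht => ?_)
    (Filter.Eventually.of_forall fun _ _ => hbound)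
    (by simp)
    (Filter.Eventually.of_forall fun t _ => hasSum_pow_mul_extensionCount (x - t) t)
  · refine hasSum_of_eq h (fun q => ?_) rfl
    rw [← integral_pow_div_factorial_mul, ← intervalIntegral.integral_const_mul]
    congr 1
    ext t
    ring
  · have ht' : |t| ≤ |x| ∧ |x - t| ≤ |x| := by
      rcases Set.mem_uIoc.1 ht with ⟨h1, h2⟩ | ⟨h1, h2⟩
      · rw [abs_of_nonneg h1.le, abs_of_nonneg (h1.le.trans h2),
          abs_of_nonneg (sub_nonneg.2 h2)]
        constructor <;> linarith
      · rw [abs_of_nonpos h2, abs_of_nonpos (h1.le.trans h2),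
          abs_of_nonpos (sub_nonpos.2 h1.le)]
        constructor <;> linarith
    simp only [norm_mul, norm_div, norm_pow, Real.norm_eq_abs, Nat.abs_cast]
    have h1 := pow_le_pow_left₀ (abs_nonneg _) ht'.1 q.2
    have h2 := pow_le_pow_left₀ (abs_nonneg _) ht'.2 q.1
    gcongr ?_ / _ * (_ * (?_ / _))

/-- The EGF `T(x) = Σ_{n ≥ 1} (xⁿ/n!) Σ_{π ∈ R_n} F_π` of the total number of
fixed points converges absolutely and `T(x) = ∫₀ˣ e^{(x-t)eᵗ + eᵗ + t - 1} dt`. -/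
theorem rgs_total_fixed_points_egf (x : ℝ) :
    Summable (fun n : ℕ =>
      |x ^ (n + 1) / (n + 1).factorial * ∑ π ∈ RGS (n + 1), (fixCount π : ℝ)|) ∧
    ∑' n : ℕ, x ^ (n + 1) / (n + 1).factorial * ∑ π ∈ RGS (n + 1), (fixCount π : ℝ)
      = ∫ t in (0:ℝ)..x, Real.exp ((x - t) * Real.exp t + Real.exp t + t - 1) := by
  have h := (Finset.HasAntidiagonal.sigmaAntidiagonalEquivProd.hasSum_iff.2
    (hasSum_integral_extensionCount x)).sigma (fun n => hasSum_fintype _)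
  have hterm : (fun n : ℕ =>
      x ^ (n + 1) / (n + 1).factorial * ∑ π ∈ RGS (n + 1), (fixCount π : ℝ)) =
      fun n : ℕ => ∑ q : Finset.HasAntidiagonal.antidiagonal n,
        (extensionCount q.1.2 (q.1.1 + 1) : ℝ) *
          (x ^ (q.1.1 + q.1.2 + 1) / (q.1.1 + q.1.2 + 1).factorial) := by
    ext n
    rw [Finset.sum_coe_sort (Finset.HasAntidiagonal.antidiagonal n) (fun q : ℕ × ℕ =>
      (extensionCount q.2 (q.1 + 1) : ℝ) *
        (x ^ (q.1 + q.2 + 1) / (q.1 + q.2 + 1).factorial)),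
      ← Nat.cast_sum, sum_fixCount, Nat.cast_sum, Finset.mul_sum]
    refine Finset.sum_congr rfl fun q hq => ?_
    rw [Finset.HasAntidiagonal.mem_antidiagonal.1 hq, mul_comm]
  have h' : HasSum (fun n : ℕ =>
      x ^ (n + 1) / (n + 1).factorial * ∑ π ∈ RGS (n + 1), (fixCount π : ℝ))
      (∫ t in (0:ℝ)..x, Real.exp ((x - t) * Real.exp t + Real.exp t + t - 1)) := by
    rw [hterm]
    exact h
  exact ⟨h'.summable.abs, h'.tsum_eq⟩
end

section
/- For every integer n ≥ 2, the following identity of rational numbers holds: Σ_{j=1}^{n−1} Σ_{ℓ=0}^{n−j−1} C(n−j−1, ℓ) · j^{n−j+1−ℓ} · B_ℓ = Σ_{i=1}^{n} Σ_{j=1}^{i} Σ_{ℓ=j}^{i} (−1)^{i−ℓ} · ℓ^{n−j} / ((ℓ−j)! · (i−ℓ)!) − n, where B_ℓ := |R_ℓ| is the ℓ-th Bell number and C(a,b) denotes the binomial coefficient. -/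
open Finset
open scoped Classical

/-- The words of length `m` continuing a restricted growth sequence with maximum `k`. -/
noncomputable def extensions : (m : ℕ) → ℕ → Finset (Fin m → ℕ)
  | 0, _ => Finset.univ
  | m + 1, k => (Finset.Icc 1 (k + 1)).biUnion fun a =>
      (extensions m (max k a)).image (Fin.cons (α := fun _ => ℕ) a)

lemma sup_filter_lt_succ {m : ℕ} (π : Fin (m + 1) → ℕ) (i : Fin m) :
    (Finset.univ.filter (fun j => j < i.succ)).sup π
      = max (π 0) ((Finset.univ.filter (fun j => j < i)).sup (Fin.tail π)) := by
  refine eq_of_forall_ge_iff fun c => ?_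
  simp [Finset.sup_le_iff, Fin.forall_fin_succ, Fin.tail]

lemma mem_extensions {m k : ℕ} {π : Fin m → ℕ} :
    π ∈ extensions m k ↔ ∀ i : Fin m, 1 ≤ π i ∧
      π i ≤ max k ((Finset.univ.filter (fun j : Fin m => j < i)).sup π) + 1 := by
  induction m generalizing k with
  | zero => exact iff_of_true (Finset.mem_univ π) fun i => i.elim0
  | succ m ih =>
    have hmem : π ∈ extensions (m + 1) k ↔
        (1 ≤ π 0 ∧ π 0 ≤ k + 1) ∧ Fin.tail π ∈ extensions m (max k (π 0)) := by
      simp only [extensions, Finset.mem_biUnion, Finset.mem_image, Finset.mem_Icc]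
      constructor
      · rintro ⟨a, ha, σ, hσ, rfl⟩
        simpa using ⟨ha, hσ⟩
      · rintro ⟨h₀, ht⟩
        exact ⟨π 0, h₀, Fin.tail π, ht, Fin.cons_self_tail π⟩
    rw [hmem, ih, Fin.forall_fin_succ]
    simp [sup_filter_lt_succ, Fin.tail, max_assoc]

lemma card_extensions (m k : ℕ) : (extensions m k).card = extensionCount m k := by
  induction m generalizing k with
  | zero => simp [extensions, extensionCount]
  | succ m ih =>
    rw [extensions, Finset.card_biUnion]
    · simp_rw [Finset.card_image_of_injective _ (Fin.cons_right_injective (α := fun _ => ℕ) _), ih]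
      rw [Finset.sum_Icc_succ_top (by omega), extensionCount,
        Finset.sum_congr rfl fun a ha => by rw [max_eq_left (Finset.mem_Icc.1 ha).2]]
      simp
    · intro a _ b _ hab
      rw [Function.onFun, Finset.disjoint_left]
      intro π ha hb
      obtain ⟨σ, -, rfl⟩ := Finset.mem_image.1 ha
      obtain ⟨τ, -, h⟩ := Finset.mem_image.1 hb
      exact hab (by simpa using (congrFun h 0).symm)

lemma IsRGS.le_succ {n : ℕ} {π : Fin n → ℕ} (h : IsRGS π) (i : Fin n) : π i ≤ i + 1 := by
  induction i using WellFoundedLT.induction with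
  | ind i ih =>
    refine (h i).2.trans (Nat.succ_le_succ (Finset.sup_le fun j hj => ?_))
    have hji : j < i := (Finset.mem_filter.1 hj).2
    exact (ih j hji).trans hji

lemma card_RGS (n : ℕ) : (RGS n).card = extensionCount n 0 := by
  rw [← card_extensions]
  congr 1
  ext π
  have h : π ∈ extensions n 0 ↔ IsRGS π := by simp [mem_extensions, IsRGS]
  rw [h, RGS, Finset.mem_filter, Fintype.mem_piFinset, and_iff_right_iff_imp]
  exact fun hπ i => Finset.mem_Icc.2 ⟨(hπ i).1, (hπ.le_succ i).trans i.isLt⟩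

lemma extensionCount_add (m j r : ℕ) :
    extensionCount m (j + r)
      = ∑ ℓ ∈ Finset.range (m + 1), m.choose ℓ * j ^ (m - ℓ) * extensionCount ℓ r := by
  induction m generalizing r with
  | zero => simp [extensionCount]
  | succ m ih =>
    have hpow : ∀ ℓ ∈ Finset.range (m + 1),
        m.choose ℓ * j ^ (m + 1 - ℓ) * extensionCount ℓ r
          = j * (m.choose ℓ * j ^ (m - ℓ) * extensionCount ℓ r) := fun ℓ hℓ => by
      rw [Nat.succ_sub (Nat.lt_succ_iff.1 (Finset.mem_range.1 hℓ)), pow_succ]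
      ring
    have hshift : ∑ ℓ ∈ Finset.range (m + 1),
          m.choose (ℓ + 1) * j ^ (m - ℓ) * extensionCount (ℓ + 1) r
          + j ^ (m + 1) * extensionCount 0 r
        = ∑ ℓ ∈ Finset.range (m + 1), j * (m.choose ℓ * j ^ (m - ℓ) * extensionCount ℓ r) := by
      rw [← Finset.sum_congr rfl hpow, Finset.sum_range_succ, Finset.sum_range_succ' _ m]
      simp
    rw [Finset.sum_range_succ']
    simp only [Nat.choose_succ_succ, add_mul, Finset.sum_add_distrib, Nat.succ_sub_succ,
      Nat.choose_zero_right, one_mul, Nat.sub_zero]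
    rw [add_assoc, hshift, extensionCount, add_assoc j r 1, ih, ih, Finset.mul_sum,
      ← Finset.sum_add_distrib, ← Finset.sum_add_distrib]
    refine Finset.sum_congr rfl fun ℓ _ => ?_
    rw [extensionCount]
    ring

/-- The explicit formula for the number of words of length `m` continuing a restricted growth
sequence with maximum `j` to one with maximum `i` (an `r`-Stirling number). -/
def stirlingSum (m j i : ℕ) : ℚ :=
  ∑ ℓ ∈ Finset.Icc j i, (-1 : ℚ) ^ (i - ℓ) * (ℓ : ℚ) ^ m
    / (((ℓ - j).factorial : ℚ) * ((i - ℓ).factorial : ℚ))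

lemma stirlingSum_succ {m j i : ℕ} (h : j ≤ i) :
    stirlingSum (m + 1) j i = j * stirlingSum m j i + stirlingSum m (j + 1) i := by
  have hterm : ∀ ℓ ∈ Finset.Icc (j + 1) i,
      (-1 : ℚ) ^ (i - ℓ) * (ℓ : ℚ) ^ (m + 1)
          / (((ℓ - j).factorial : ℚ) * ((i - ℓ).factorial : ℚ))
        = j * ((-1 : ℚ) ^ (i - ℓ) * (ℓ : ℚ) ^ m
            / (((ℓ - j).factorial : ℚ) * ((i - ℓ).factorial : ℚ)))
          + (-1 : ℚ) ^ (i - ℓ) * (ℓ : ℚ) ^ m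
            / (((ℓ - (j + 1)).factorial : ℚ) * ((i - ℓ).factorial : ℚ)) := fun ℓ hℓ => by
    obtain ⟨d, rfl⟩ := Nat.exists_eq_add_of_le (Finset.mem_Icc.1 hℓ).1
    rw [show j + 1 + d - j = d + 1 by omega, show j + 1 + d - (j + 1) = d by omega,
      Nat.factorial_succ]
    have := Nat.factorial_ne_zero d
    have := Nat.factorial_ne_zero (i - (j + 1 + d))
    push_cast
    field_simp
    ring
  unfold stirlingSum
  rw [← Finset.add_sum_Ioc_eq_sum_Icc h, ← Finset.add_sum_Ioc_eq_sum_Icc h,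
    ← Finset.Icc_add_one_left_eq_Ioc, Finset.sum_congr rfl hterm, Finset.sum_add_distrib,
    ← Finset.mul_sum]
  ring

lemma stirlingSum_zero (j d : ℕ) : stirlingSum 0 j (j + d) = 0 ^ d := by
  have h := add_pow (1 : ℚ) (-1) d
  have hd : (d.factorial : ℚ) ≠ 0 := by exact_mod_cast d.factorial_ne_zero
  rw [add_neg_cancel] at h
  have : (0 : ℚ) ^ d = 0 ^ d / d.factorial := by
    rcases d.eq_zero_or_pos with rfl | hpos
    · simp
    · simp [hpos.ne']
  rw [this, h, Finset.sum_div, stirlingSum, ← Finset.Ico_add_one_right_eq_Icc,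
    Finset.sum_Ico_eq_sum_range, show j + d + 1 - j = d + 1 by omega]
  refine Finset.sum_congr rfl fun k hk => ?_
  rw [Nat.add_sub_add_left, Nat.add_sub_cancel_left,
    Nat.cast_choose ℚ (Nat.lt_succ_iff.1 (Finset.mem_range.1 hk))]
  have := Nat.factorial_ne_zero k
  have := Nat.factorial_ne_zero (d - k)
  field_simp
  simp

lemma sum_stirlingSum {m j N : ℕ} (h : j + m ≤ N) :
    ∑ i ∈ Finset.Icc j N, stirlingSum m j i = extensionCount m j := by
  induction m generalizing j with
  | zero =>
    rw [Finset.sum_eq_single_of_mem j (Finset.left_mem_Icc.2 h)]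
    · simpa [extensionCount] using stirlingSum_zero j 0
    · intro i hi hij
      obtain ⟨d, rfl⟩ := Nat.exists_eq_add_of_le (Finset.mem_Icc.1 hi).1
      rw [stirlingSum_zero, zero_pow (by omega)]
  | succ m ih =>
    rw [Finset.sum_congr rfl fun i hi => stirlingSum_succ (Finset.mem_Icc.1 hi).1,
      Finset.sum_add_distrib, ← Finset.mul_sum, ih (by omega),
      ← Finset.add_sum_Ioc_eq_sum_Icc (show j ≤ N by omega)
        (f := fun i => stirlingSum m (j + 1) i),
      ← Finset.Icc_add_one_left_eq_Ioc, ih (by omega), extensionCount]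
    simp [stirlingSum]

lemma sum_mul_sub_succ (a : ℕ → ℚ) (N : ℕ) :
    ∑ j ∈ Finset.Icc 1 N, (j : ℚ) * (a j - a (j + 1))
      = ∑ j ∈ Finset.Icc 1 (N + 1), a j - (N + 1) * a (N + 1) := by
  induction N with
  | zero => simp
  | succ N ih =>
    rw [Finset.sum_Icc_succ_top (by omega), ih, Finset.sum_Icc_succ_top (b := N + 1) (by omega)]
    push_cast
    ring

/-- For `n ≥ 2`, the identity of rational numbers
`Σ_{j=1}^{n-1} Σ_{ℓ=0}^{n-j-1} C(n-j-1, ℓ) j^{n-j+1-ℓ} B_ℓ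
  = Σ_{i=1}^{n} Σ_{j=1}^{i} Σ_{ℓ=j}^{i} (-1)^{i-ℓ} ℓ^{n-j} / ((ℓ-j)! (i-ℓ)!) - n`,
where `B_ℓ = |R_ℓ|`. -/
theorem rgs_bell_identity (n : ℕ) (hn : 2 ≤ n) :
    ∑ j ∈ Finset.Icc 1 (n - 1), ∑ ℓ ∈ Finset.range (n - j - 1 + 1),
        ((n - j - 1).choose ℓ : ℚ) * (j : ℚ) ^ (n - j + 1 - ℓ) * ((RGS ℓ).card : ℚ)
      = (∑ i ∈ Finset.Icc 1 n, ∑ j ∈ Finset.Icc 1 i, ∑ ℓ ∈ Finset.Icc j i,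
          (-1 : ℚ) ^ (i - ℓ) * (ℓ : ℚ) ^ (n - j)
            / (((ℓ - j).factorial : ℚ) * ((i - ℓ).factorial : ℚ))) - n := by
  have hleft : ∀ j ∈ Finset.Icc 1 (n - 1), ∑ ℓ ∈ Finset.range (n - j - 1 + 1),
      ((n - j - 1).choose ℓ : ℚ) * (j : ℚ) ^ (n - j + 1 - ℓ) * ((RGS ℓ).card : ℚ)
        = j * ((extensionCount (n - j) j : ℚ) - extensionCount (n - (j + 1)) (j + 1)) := by
    intro j hj
    obtain ⟨m, rfl⟩ : ∃ m, n = j + 1 + m :=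
      Nat.exists_eq_add_of_le (by have := Finset.mem_Icc.1 hj; omega)
    have h := extensionCount_add m j 0
    rw [add_zero] at h
    rw [show j + 1 + m - j = m + 1 by omega, Nat.add_sub_cancel, Nat.add_sub_cancel_left,
      extensionCount]
    push_cast
    rw [add_sub_cancel_right, h]
    push_cast
    rw [Finset.mul_sum, Finset.mul_sum]
    refine Finset.sum_congr rfl fun ℓ hℓ => ?_
    rw [card_RGS, show m + 1 + 1 - ℓ = m - ℓ + 2 by have := Finset.mem_range.1 hℓ; omega]
    ring
  have hright : ∑ i ∈ Finset.Icc 1 n, ∑ j ∈ Finset.Icc 1 i, stirlingSum (n - j) j i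
      = ∑ j ∈ Finset.Icc 1 n, (extensionCount (n - j) j : ℚ) := by
    rw [Finset.sum_comm' (t' := Finset.Icc 1 n) (s' := fun j => Finset.Icc j n)
      (by intro i j; simp only [Finset.mem_Icc]; omega)]
    refine Finset.sum_congr rfl fun j hj => sum_stirlingSum ?_
    have := Finset.mem_Icc.1 hj
    omega
  have hsum := sum_mul_sub_succ (fun j => (extensionCount (n - j) j : ℚ)) (n - 1)
  rw [Finset.sum_congr rfl hleft, hsum]
  unfold stirlingSum at hright
  rw [hright]
  obtain ⟨N, rfl⟩ : ∃ N, n = N + 1 := ⟨n - 1, by omega⟩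
  simp [extensionCount]
end
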